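/- For all positive integers a and b, the number of spanning trees of the complete bipartite graph K_{a,b} is a^{b-1} · b^{a-1}. -/

import Mathlib

namespace ParentMap

variable {V : Type*} {r : V}

/-- `IsParent p w v` says that `w` is the parent of the non-root vertex `v`, where `p` assigns
a parent to every vertex other than the root `r`. -/
def IsParent (p : {v // v ≠ r} → V) (w v : V) : Prop :=
  ∃ h : v ≠ r, p ⟨v, h⟩ = w

lemma isParent_apply (p : {v // v ≠ r} → V) (v : {v // v ≠ r}) : IsParent p (p v) v :=
  ⟨v.2, rfl⟩

lemma acc_root (p : {v // v ≠ r} → V) : Acc (IsParent p) r :=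
  ⟨_, fun _ ⟨h, _⟩ ↦ absurd rfl h⟩

lemma acc_apply_iff (p : {v // v ≠ r} → V) (v : {v // v ≠ r}) :
    Acc (IsParent p) (p v) ↔ Acc (IsParent p) v :=
  ⟨fun h ↦ ⟨_, fun _ ⟨_, hw⟩ ↦ hw ▸ h⟩, fun h ↦ h.inv (isParent_apply p v)⟩

/-- The undirected graph joining every non-root vertex to its parent. -/
def toGraph (p : {v // v ≠ r} → V) : SimpleGraph V :=
  SimpleGraph.fromRel (IsParent p)

lemma toGraph_adj (p : {v // v ≠ r} → V) (v w : V) :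
    (toGraph p).Adj v w ↔ v ≠ w ∧ (IsParent p v w ∨ IsParent p w v) := Iff.rfl

lemma toGraph_le {G : SimpleGraph V} {p : {v // v ≠ r} → V} (hp : ∀ v : {v // v ≠ r}, G.Adj v (p v)) :
    toGraph p ≤ G := by
  rintro v w ⟨-, ⟨h, rfl⟩ | ⟨h, rfl⟩⟩
  · exact (hp _).symm
  · exact hp ⟨v, h⟩

lemma apply_ne {p : {v // v ≠ r} → V} (hp : WellFounded (IsParent p)) (v : {v // v ≠ r}) :
    p v ≠ v := fun h ↦
  hp.asymmetric _ _ (h ▸ isParent_apply p v) (h ▸ isParent_apply p v)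

lemma toGraph_adj_apply {p : {v // v ≠ r} → V} (hp : WellFounded (IsParent p))
    (v : {v // v ≠ r}) : (toGraph p).Adj v (p v) :=
  ⟨(apply_ne hp v).symm, Or.inr (isParent_apply p v)⟩

lemma connected_toGraph {p : {v // v ≠ r} → V} (hp : WellFounded (IsParent p)) :
    (toGraph p).Connected := by
  have hr : ∀ v, (toGraph p).Reachable v r := fun v ↦ by
    induction v using hp.induction with
    | _ v ih =>
      by_cases h : v = r
      · rw [h]
      · exact (toGraph_adj_apply hp ⟨v, h⟩).reachable.trans (ih _ ⟨h, rfl⟩)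
  exact { preconnected := fun v w ↦ (hr v).trans (hr w).symm, nonempty := ⟨r⟩ }

lemma isTree_toGraph [Finite V] {p : {v // v ≠ r} → V} (hp : WellFounded (IsParent p)) :
    (toGraph p).IsTree := by
  rw [SimpleGraph.isTree_iff_connected_and_card]
  have hconn := connected_toGraph hp
  refine ⟨hconn, le_antisymm ?_ hconn.card_vert_le_card_edgeSet_add_one⟩
  have hsurj : Function.Surjective
      fun v : {v // v ≠ r} ↦ (⟨s(v.1, p v), toGraph_adj_apply hp v⟩ : (toGraph p).edgeSet) := by
    rintro ⟨e, he⟩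
    induction e with
    | _ v w =>
      obtain ⟨-, ⟨h, hw⟩ | ⟨h, hw⟩⟩ := he
      · exact ⟨⟨w, h⟩, Subtype.ext ((congrArg _ hw).trans Sym2.eq_swap)⟩
      · exact ⟨⟨v, h⟩, Subtype.ext (congrArg (Sym2.mk v) hw)⟩
  have hle : Nat.card (toGraph p).edgeSet ≤ Nat.card {v // v ≠ r} := Nat.card_le_card_of_surjective _ hsurj
  have hcard : Nat.card {v // v ≠ r} + 1 = Nat.card V := by
    classical
    rw [← Finite.card_option]
    exact Nat.card_congr (Equiv.optionSubtypeNe r)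
  omega

lemma eq_of_toGraph_eq {p q : {v // v ≠ r} → V} (hp : WellFounded (IsParent p))
    (h : toGraph p = toGraph q) : p = q := by
  suffices H : ∀ v (hv : v ≠ r), p ⟨v, hv⟩ = q ⟨v, hv⟩ from funext fun v ↦ H v.1 v.2
  intro v
  induction v using hp.induction with
  | _ v ih =>
    intro hv
    have hpv : IsParent p (p ⟨v, hv⟩) v := ⟨hv, rfl⟩
    have hadj := h ▸ toGraph_adj_apply hp ⟨v, hv⟩
    obtain ⟨-, ⟨hr, hq⟩ | ⟨_, hq⟩⟩ := hadj
    · exact absurd (show IsParent p v _ from ⟨hr, (ih _ hpv hr).trans hq⟩) (hp.asymmetric _ _ hpv)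
    · exact hq.symm

lemma exists_toGraph_eq {T : SimpleGraph V} (hT : T.IsTree) (r : V) :
    ∃ p : {v // v ≠ r} → V, WellFounded (IsParent p) ∧ toGraph p = T := by
  have hex : ∀ v : {v // v ≠ r}, ∃ w, T.Adj v w ∧ T.dist w r < T.dist v r := by
    rintro ⟨v, hv⟩
    obtain ⟨c, hc⟩ := hT.connected.exists_walk_length_eq_dist v r
    cases c with
    | nil => exact absurd rfl hv
    | cons hadj c =>
      refine ⟨_, hadj, ?_⟩
      have := T.dist_le c
      rw [SimpleGraph.Walk.length_cons] at hc
      dsimp only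
      omega
  choose p hadj hdist using hex
  have hp : WellFounded (IsParent p) :=
    Subrelation.wf (fun {_ v} ⟨hv, h⟩ ↦ h ▸ hdist ⟨v, hv⟩) (measure fun v ↦ T.dist v r).wf
  have hle := toGraph_le hadj
  exact ⟨p, hp, le_antisymm hle
    ((SimpleGraph.isTree_iff_minimal_connected.1 hT).le_of_le (connected_toGraph hp) hle)⟩

/-- Spanning trees of `G` correspond to the well-founded choices of a parent
for every non-root vertex. -/
lemma card_spanningTrees_eq [Finite V] (G : SimpleGraph V) (r : V) :
    Nat.card {T : SimpleGraph V // T ≤ G ∧ T.IsTree} =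
      Nat.card {p : {v // v ≠ r} → V // (∀ v : {v // v ≠ r}, G.Adj v (p v)) ∧ WellFounded (IsParent p)} := by
  symm
  refine Nat.card_eq_of_bijective
    (fun p ↦ ⟨toGraph p.1, toGraph_le p.2.1, isTree_toGraph p.2.2⟩) ⟨?_, ?_⟩
  · intro p q h
    exact Subtype.ext (eq_of_toGraph_eq p.2.2 (congrArg Subtype.val h))
  · rintro ⟨T, hTG, hT⟩
    obtain ⟨p, hp, rfl⟩ := exists_toGraph_eq hT r
    exact ⟨⟨p, fun v ↦ hTG (toGraph_adj_apply hp v), hp⟩, rfl⟩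

variable (R : Type*) [DecidableEq V]

/-- The matrix whose row at `v` is the indicator of `v` minus the indicator of the parent of `v`,
with the root column removed. -/
def matrix [Ring R] (p : {v // v ≠ r} → V) : Matrix {v // v ≠ r} {v // v ≠ r} R :=
  Matrix.of fun v u ↦ (if v = u then 1 else 0) - if p v = u then 1 else 0

lemma det_matrix_of_wellFounded [Fintype V] [CommRing R] {p : {v // v ≠ r} → V}
    (hp : WellFounded (IsParent p)) : (matrix R p).det = 1 := by
  have : IsWellFounded V (IsParent p) := ⟨hp⟩
  have hlt : ∀ v u : {v // v ≠ r}, p v = u →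
      IsWellFounded.rank (IsParent p) u.1 < IsWellFounded.rank (IsParent p) v.1 :=
    fun v u h ↦ IsWellFounded.rank_lt_of_rel (h ▸ isParent_apply p v)
  have htri : (matrix R p).BlockTriangular
      fun v ↦ OrderDual.toDual (IsWellFounded.rank (IsParent p) v.1) := by
    intro v u h
    have h' := OrderDual.toDual_lt_toDual.1 h
    have h1 : v ≠ u := by rintro rfl; exact lt_irrefl _ h'
    have h2 : p v ≠ u := fun e ↦ lt_asymm (hlt _ _ e) h'
    simp [matrix, h1, h2]
  rw [htri.det]
  refine Finset.prod_eq_one fun k _ ↦ ?_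
  have hone : (matrix R p).toSquareBlock
      (fun v ↦ OrderDual.toDual (IsWellFounded.rank (IsParent p) v.1)) k = 1 := by
    ext ⟨v, hv⟩ ⟨u, hu⟩
    have h2 : p v ≠ u := fun e ↦
      (hlt _ _ e).ne (OrderDual.toDual.injective (hu.trans hv.symm))
    simp [matrix, Matrix.toSquareBlock_def, h2, Matrix.one_apply, Subtype.ext_iff]
  rw [hone, Matrix.det_one]

lemma det_matrix_of_not_wellFounded [Fintype V] [CommRing R] [IsDomain R] {p : {v // v ≠ r} → V}
    (hp : ¬ WellFounded (IsParent p)) : (matrix R p).det = 0 := by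
  classical
  rw [← Matrix.exists_mulVec_eq_zero_iff]
  obtain ⟨v, hv⟩ : ∃ v, ¬ Acc (IsParent p) v := by
    by_contra! h
    exact hp ⟨h⟩
  have hvr : v ≠ r := fun h ↦ hv (h ▸ acc_root p)
  refine ⟨fun u ↦ if Acc (IsParent p) u.1 then 0 else 1,
    fun h ↦ by simpa [hv] using congrFun h ⟨v, hvr⟩, ?_⟩
  ext v
  have hsum : ∑ u : {v // v ≠ r}, (if p v = u then (if Acc (IsParent p) u.1 then 0 else 1) else 0)
      = if Acc (IsParent p) (p v) then (0 : R) else 1 := by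
    by_cases h : p v = r
    · rw [h, if_pos (acc_root p)]
      exact Finset.sum_eq_zero fun u _ ↦ if_neg u.2.symm
    · rw [Finset.sum_eq_single ⟨p v, h⟩ (fun u _ hu ↦ if_neg fun e ↦ hu (Subtype.ext e.symm))
        (by simp)]
      simp
  simp only [Matrix.mulVec, dotProduct, matrix, Matrix.of_apply, sub_mul, ite_mul, one_mul,
    zero_mul, Finset.sum_sub_distrib, hsum, acc_apply_iff]
  simp

end ParentMap

open ParentMap in
/-- Kirchhoff's **matrix-tree theorem**: the number of spanning trees of a finite graph is the
determinant of its Laplacian matrix with the row and column of one vertex removed. -/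
theorem card_spanningTrees_eq_det_lapMatrix {V : Type*} [Fintype V] [DecidableEq V]
    (R : Type*) [CommRing R] [IsDomain R] (G : SimpleGraph V) [DecidableRel G.Adj] (r : V) :
    (Nat.card {T : SimpleGraph V // T ≤ G ∧ T.IsTree} : R) =
      ((G.lapMatrix R).submatrix (Subtype.val : {v // v ≠ r} → V) Subtype.val).det := by
  classical
  have hrows : (G.lapMatrix R).submatrix (Subtype.val : {v // v ≠ r} → V) Subtype.val =
      fun v ↦ ∑ w ∈ G.neighborFinset v.1, fun u : {v // v ≠ r} ↦
        (if v = u then (1 : R) else 0) - if w = u.1 then 1 else 0 := by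
    ext v u
    simp [Finset.sum_apply, SimpleGraph.lapMatrix, SimpleGraph.degMatrix, Matrix.diagonal_apply,
      Subtype.ext_iff, SimpleGraph.adjMatrix_apply]
  rw [card_spanningTrees_eq G r, hrows]
  change _ = Matrix.detRowAlternating.toMultilinearMap _
  rw [MultilinearMap.map_sum_finset]
  calc
    _ = ∑ p ∈ Fintype.piFinset fun v : {v // v ≠ r} ↦ G.neighborFinset v.1,
        if WellFounded (IsParent p) then (1 : R) else 0 := by
      rw [Finset.sum_boole, Nat.card_eq_fintype_card, Fintype.card_subtype]
      congr 2
      ext p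
      simp
    _ = _ := Finset.sum_congr rfl fun p _ ↦ by
      change _ = (matrix R p).det
      split_ifs with hp
      · rw [det_matrix_of_wellFounded R hp]
      · rw [det_matrix_of_not_wellFounded R hp]

lemma det_fromBlocks_completeBipartite {K : Type*} [Field K] {m n : Type*} [Fintype m] [Fintype n]
    [DecidableEq m] [DecidableEq n] {x y : K} (hx : x ≠ 0) (hy : y ≠ 0) :
    (Matrix.fromBlocks (x • (1 : Matrix m m K)) (Matrix.of fun _ _ ↦ -1)
      (Matrix.of fun _ _ ↦ -1) (y • (1 : Matrix n n K))).det =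
    x ^ Fintype.card m * y ^ Fintype.card n *
      (1 - Fintype.card m * Fintype.card n / (x * y)) := by
  let hinv : Invertible (x • (1 : Matrix m m K)) :=
    ⟨x⁻¹ • 1, by simp [smul_smul, hx], by simp [smul_smul, hx]⟩
  have hschur : y • (1 : Matrix n n K) -
      (Matrix.of fun _ _ ↦ -1 : Matrix n m K) * ⅟(x • (1 : Matrix m m K)) *
        (Matrix.of fun _ _ ↦ -1 : Matrix m n K) =
      y • (1 + Matrix.replicateCol Unit (fun _ : n ↦ -(Fintype.card m / (x * y) : K)) *
        Matrix.replicateRow Unit fun _ : n ↦ (1 : K)) := by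
    have hinvOf : ⅟(x • (1 : Matrix m m K)) = x⁻¹ • 1 := rfl
    ext i j
    simp [hinvOf, Matrix.mul_apply, Matrix.one_apply]
    field_simp
    split_ifs <;> ring
  rw [Matrix.det_fromBlocks₁₁, hschur, Matrix.det_smul, Matrix.det_smul, Matrix.det_one,
    Matrix.det_one_add_replicateCol_mul_replicateRow]
  simp [dotProduct]
  ring

/-- Scoins' formula. For all positive integers `a` and `b`, the number of
spanning trees of the complete bipartite graph `K_{a,b}` is `a^(b-1) * b^(a-1)`.
A spanning tree of `K_{a,b}` is a subgraph (a simple graph on the same vertex set which is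
edgewise contained in `K_{a,b}`) which is a tree; being connected, it automatically contains
every vertex. -/
theorem scoins_spanning_trees (a b : ℕ) (ha : 0 < a) (hb : 0 < b) :
    Nat.card {T : SimpleGraph (Fin a ⊕ Fin b) //
      T ≤ completeBipartiteGraph (Fin a) (Fin b) ∧ T.IsTree} =
    a ^ (b - 1) * b ^ (a - 1) := by
  classical
  obtain ⟨n, rfl⟩ := Nat.exists_eq_add_one_of_ne_zero ha.ne'
  have hx : (b : ℚ) ≠ 0 := by exact_mod_cast hb.ne'
  have hy : (n : ℚ) + 1 ≠ 0 := by positivity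
  let e : Fin n ⊕ Fin b ≃ {v : Fin (n + 1) ⊕ Fin b // v ≠ Sum.inl 0} :=
    Equiv.ofBijective
      (Sum.elim (fun i ↦ ⟨Sum.inl i.succ, by simp⟩) fun j ↦ ⟨Sum.inr j, by simp⟩) <| by
      constructor
      · rintro (i | i) (j | j) h <;> simp_all
      · rintro ⟨i | j, h⟩
        · obtain ⟨k, rfl⟩ := Fin.exists_succ_eq.2 fun hi : i = 0 ↦ h (hi ▸ rfl)
          exact ⟨Sum.inl k, rfl⟩
        · exact ⟨Sum.inr j, rfl⟩
  have hl (i) : (e (Sum.inl i)).1 = Sum.inl i.succ := rfl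
  have hr (j) : (e (Sum.inr j)).1 = Sum.inr j := rfl
  have hblocks : (((completeBipartiteGraph (Fin (n + 1)) (Fin b)).lapMatrix ℚ).submatrix
      (Subtype.val : {v : Fin (n + 1) ⊕ Fin b // v ≠ Sum.inl 0} → _) Subtype.val).submatrix e e =
      Matrix.fromBlocks ((b : ℚ) • (1 : Matrix (Fin n) (Fin n) ℚ)) (Matrix.of fun _ _ ↦ -1)
        (Matrix.of fun _ _ ↦ -1) (((n : ℚ) + 1) • (1 : Matrix (Fin b) (Fin b) ℚ)) := by
    ext (i | i) (j | j) <;>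
    simp [hl, hr, SimpleGraph.lapMatrix, SimpleGraph.degMatrix, Matrix.diagonal_apply,
      SimpleGraph.adjMatrix_apply, Matrix.one_apply, SimpleGraph.degree_eq_sum_if_adj,
      Fintype.sum_sum_type, -Finset.sum_boole]
  have key := card_spanningTrees_eq_det_lapMatrix ℚ
    (completeBipartiteGraph (Fin (n + 1)) (Fin b)) (Sum.inl 0)
  rw [← Matrix.det_submatrix_equiv_self e, hblocks, det_fromBlocks_completeBipartite hx hy] at key
  obtain ⟨m, rfl⟩ := Nat.exists_eq_add_one_of_ne_zero hb.ne'
  have hval : (Nat.card {T : SimpleGraph (Fin (n + 1) ⊕ Fin (m + 1)) //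
      T ≤ completeBipartiteGraph (Fin (n + 1)) (Fin (m + 1)) ∧ T.IsTree} : ℚ) =
      (n + 1) ^ m * (m + 1) ^ n := by
    rw [key]
    push_cast [Fintype.card_fin] at hx ⊢
    field_simp
    ring
  simpa only [Nat.add_sub_cancel] using mod_cast hval
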